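/- arXiv:2202.03919 — 2 statements merged into one kernel-verified Lean document; each statement's English description precedes it below -/
import Mathlib

section
/- Let t ≠ 0, ε > 0, 0 ≤ q ≤ 3, κ > 0, and let γ̃ : ℝ → ℝ satisfy (1/2)|γ̃(0)| ≤ |γ̃(k)| ≤ (3/2)|γ̃(0)| for |k| ≤ κ with γ̃(0) ≠ 0. Assume 0 < ε|t|^{-1} ≤ (2π)^{-1}|γ̃(0)|κ³. Then sup over |k| ≤ κ of ε^q (k² + ε²)^{-q/2} |sin((1/2) t ε^{-1} |k|³ γ̃(k))| ≤ C · ε^{2q/3}|t|^{q/3} / (|γ̃(0)|^{-2/3} + ε^{4/3}|t|^{2/3})^{q/2}, for some constant C depending only on q. -/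
open Real

lemma aux_core (q : ℝ) (hq0 : 0 ≤ q) (hq3 : q ≤ 3) (a b c k s : ℝ) (ha : 0 < a) (hb : 0 < b)
    (hc : 0 < c) (hs0 : 0 ≤ s) (hs1 : s ≤ 1) (hs : s ≤ (|k| * b * c / a) ^ 3) :
    (a ^ 6 / (k ^ 2 + a ^ 6)) ^ (q / 2) * s ≤
      (a ^ 4 * b ^ 2 / ((c ^ 2)⁻¹ + a ^ 4 * b ^ 2)) ^ (q / 2) := by
  set Q := a ^ 6 / (k ^ 2 + a ^ 6) with hQ
  set P := a ^ 4 * b ^ 2 / ((c ^ 2)⁻¹ + a ^ 4 * b ^ 2) with hP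
  have hQ0 : 0 < Q := by positivity
  have hP0 : 0 < P := by positivity
  rcases le_or_gt Q P with h | h
  · calc Q ^ (q / 2) * s ≤ Q ^ (q / 2) * 1 := by gcongr
      _ ≤ P ^ (q / 2) := by rw [mul_one]; gcongr
  · have hx1 : P / Q < 1 := by rwa [div_lt_one hQ0]
    have hx0 : 0 < P / Q := by positivity
    have hx : P / Q = (k ^ 2 + a ^ 6) * (b * c) ^ 2 / (a ^ 2 + a ^ 6 * (b * c) ^ 2) := by
      rw [hP, hQ]; field_simp
    set w := |k| * b * c / a with hw
    have hw0 : 0 ≤ w := by positivity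
    have hw2 : w ^ 2 = k ^ 2 * (b * c) ^ 2 / a ^ 2 := by
      rw [hw, div_pow, mul_pow, mul_pow, sq_abs]; ring
    have hu1 : k ^ 2 * (b * c) ^ 2 < a ^ 2 := by
      rw [hx, div_lt_one (by positivity)] at hx1
      nlinarith
    have hux : w ^ 2 ≤ P / Q := by
      rw [hx, hw2, div_le_div_iff₀ (by positivity) (by positivity)]
      have : 0 ≤ a ^ 6 * (b * c) ^ 2 * (a ^ 2 - k ^ 2 * (b * c) ^ 2) :=
        mul_nonneg (by positivity) (by linarith)
      nlinarith
    have h3 : w ^ 3 = (w ^ 2) ^ ((3:ℝ) / 2) := by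
      rw [← Real.rpow_natCast w 2, ← Real.rpow_mul hw0, ← Real.rpow_natCast w 3]; norm_num
    have hsx : s ≤ (P / Q) ^ (q / 2) := by
      calc s ≤ w ^ 3 := hs
        _ = (w ^ 2) ^ ((3:ℝ) / 2) := h3
        _ ≤ (P / Q) ^ ((3:ℝ) / 2) := by gcongr
        _ ≤ (P / Q) ^ (q / 2) :=
          Real.rpow_le_rpow_of_exponent_ge hx0 hx1.le (by linarith)
    calc Q ^ (q / 2) * s ≤ Q ^ (q / 2) * (P / Q) ^ (q / 2) := by gcongr
      _ = P ^ (q / 2) := by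
        rw [← Real.mul_rpow hQ0.le hx0.le, mul_div_cancel₀ _ hQ0.ne']

lemma aux_root (x : ℝ) (hx : 0 < x) : ∃ a : ℝ, 0 < a ∧ x = a ^ 3 :=
  ⟨x ^ ((1:ℝ) / 3), by positivity, by
    rw [← Real.rpow_natCast, ← Real.rpow_mul hx.le]; norm_num⟩

lemma aux_pow (a : ℝ) (ha : 0 < a) (r : ℝ) : (a ^ 3) ^ r = a ^ (3 * r) := by
  rw [← Real.rpow_natCast a 3, ← Real.rpow_mul ha.le]; norm_num

/-- upper bound in Lemma 2, estimate (2), for `0 ≤ q ≤ 3`, with a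
constant depending only on `q`. -/
theorem stmt11 (q : ℝ) (hq0 : 0 ≤ q) (hq3 : q ≤ 3) :
    ∃ C : ℝ, 0 < C ∧
      ∀ (t ε κ : ℝ) (γ' : ℝ → ℝ), t ≠ 0 → 0 < ε → 0 < κ → γ' 0 ≠ 0 →
        (∀ k : ℝ, |k| ≤ κ → (1 / 2) * |γ' 0| ≤ |γ' k|) →
        (∀ k : ℝ, |k| ≤ κ → |γ' k| ≤ (3 / 2) * |γ' 0|) →
        ε * |t|⁻¹ ≤ (2 * π)⁻¹ * |γ' 0| * κ ^ 3 →
        ∀ k : ℝ, |k| ≤ κ →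
          ε ^ q * (k ^ 2 + ε ^ 2) ^ (-q / 2) *
              |Real.sin ((1 / 2) * t * ε⁻¹ * |k| ^ 3 * γ' k)|
            ≤ C * ε ^ (2 * q / 3) * |t| ^ (q / 3) /
                (|γ' 0| ^ (-(2:ℝ)/3) + ε ^ ((4:ℝ)/3) * |t| ^ ((2:ℝ)/3)) ^ (q / 2) := by
  refine ⟨1, one_pos, ?_⟩
  intro t ε κ γ' ht hε hκ hγ _ hup _ k hk
  have hs : |Real.sin ((1 / 2) * t * ε⁻¹ * |k| ^ 3 * γ' k)| ≤ |t| * ε⁻¹ * |k| ^ 3 * |γ' 0| := by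
    refine (Real.abs_sin_le_abs).trans ?_
    rw [abs_mul, abs_mul, abs_mul, abs_mul, abs_pow, abs_abs, abs_of_pos (inv_pos.2 hε)]
    have h1 := hup k hk
    have h2 : |(1:ℝ) / 2| = 1 / 2 := by norm_num
    rw [h2]
    calc 1 / 2 * |t| * ε⁻¹ * |k| ^ 3 * |γ' k|
        ≤ 1 / 2 * |t| * ε⁻¹ * |k| ^ 3 * (2 * |γ' 0|) := by
          gcongr
          linarith [abs_nonneg (γ' 0)]
      _ = _ := by ring
  have hs1 := Real.abs_sin_le_one ((1 / 2) * t * ε⁻¹ * |k| ^ 3 * γ' k)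
  have hs0 := abs_nonneg (Real.sin ((1 / 2) * t * ε⁻¹ * |k| ^ 3 * γ' k))
  generalize |Real.sin ((1 / 2) * t * ε⁻¹ * |k| ^ 3 * γ' k)| = s at *
  have hT : 0 < |t| := abs_pos.2 ht
  have hg : 0 < |γ' 0| := abs_pos.2 hγ
  generalize |t| = T at *
  generalize |γ' 0| = g at *
  obtain ⟨a, ha, rfl⟩ := aux_root ε hε
  obtain ⟨b, hb, rfl⟩ := aux_root T hT
  obtain ⟨c, hc, rfl⟩ := aux_root g hg
  have hs' : s ≤ (|k| * b * c / a) ^ 3 := by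
    refine hs.trans (le_of_eq ?_)
    field_simp
  have key := aux_core q hq0 hq3 a b c k s ha hb hc hs0 hs1 hs'
  have e1 : (c ^ 3) ^ (-(2:ℝ)/3) = (c ^ 2)⁻¹ := by
    rw [aux_pow c hc, ← Real.rpow_natCast c 2, ← Real.rpow_neg hc.le]; norm_num
  have e2 : (a ^ 3) ^ ((4:ℝ)/3) = a ^ 4 := by
    rw [aux_pow a ha, ← Real.rpow_natCast a 4]; norm_num
  have e3 : (b ^ 3) ^ ((2:ℝ)/3) = b ^ 2 := by
    rw [aux_pow b hb, ← Real.rpow_natCast b 2]; norm_num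
  have e4 : (a ^ 3) ^ (2 * q / 3) = (a ^ 4) ^ (q / 2) := by
    rw [aux_pow a ha, ← Real.rpow_natCast a 4, ← Real.rpow_mul ha.le]; congr 1; push_cast; ring
  have e5 : (b ^ 3) ^ (q / 3) = (b ^ 2) ^ (q / 2) := by
    rw [aux_pow b hb, ← Real.rpow_natCast b 2, ← Real.rpow_mul hb.le]; congr 1; push_cast; ring
  have e6 : (a ^ 3) ^ q = (a ^ 6) ^ (q / 2) := by
    rw [aux_pow a ha, ← Real.rpow_natCast a 6, ← Real.rpow_mul ha.le]; congr 1; push_cast; ring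
  have e7 : (a ^ 3) ^ 2 = a ^ 6 := by ring
  rw [e1, e2, e3, e4, e5, e6, e7, one_mul, ← Real.mul_rpow (by positivity) (by positivity),
    ← Real.div_rpow (by positivity) (by positivity), neg_div, Real.rpow_neg (by positivity),
    ← div_eq_mul_inv, ← Real.div_rpow (by positivity) (by positivity)]
  exact key
end

section
/- Let t ≠ 0, ε > 0, −1 ≤ r ≤ 2, κ > 0, γ̃ : ℝ → ℝ with (1/2)|γ̃(0)| ≤ |γ̃(k)| ≤ (3/2)|γ̃(0)| on [−κ, κ] and γ̃(0) ≠ 0, and 0 < ε|t|^{-1} ≤ (2π)^{-1}|γ̃(0)|κ³. Then sup over 0 < |k| ≤ κ of ε^r (k² + ε²)^{-r/2} |k|^{-1} |sin((1/2) t ε^{-1} |k|³ γ̃(k))| ≤ C · ε^{(2r−1)/3}|t|^{(r+1)/3} / (|γ̃(0)|^{-1/3}(|γ̃(0)|^{-2/3} + ε^{4/3}|t|^{2/3})^{r/2}), for some constant C depending only on r. -/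
open Real

lemma aux_key (r e m q s : ℝ) (hr1 : -1 ≤ r) (hr2 : r ≤ 2) (he : 0 < e) (hm : 0 < m)
    (hq : 0 < q) (hs0 : 0 ≤ s) (hs1 : s ≤ 1) (hs : s ≤ (m / q) ^ 3) :
    (m ^ 2 + e ^ 2) ^ (-r / 2) * m⁻¹ * s ≤ (q ^ 2 + e ^ 2) ^ (-r / 2) * q⁻¹ := by
  have hA : 0 < m ^ 2 + e ^ 2 := by positivity
  have hB : 0 < q ^ 2 + e ^ 2 := by positivity
  have hP := rpow_pos_of_pos hB (-r / 2)
  have hP' := rpow_pos_of_pos hA (-r / 2)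
  rcases le_total q m with h | h
  · have h1 : 1 ≤ (m ^ 2 + e ^ 2) / (q ^ 2 + e ^ 2) := by
      rw [one_le_div hB]; gcongr
    have h2 : (m ^ 2 + e ^ 2) / (q ^ 2 + e ^ 2) ≤ (m / q) ^ 2 := by
      rw [div_pow, div_le_div_iff₀ hB (by positivity)]
      have : q ^ 2 ≤ m ^ 2 := by gcongr
      nlinarith [sq_nonneg e]
    have h3 : ((m ^ 2 + e ^ 2) / (q ^ 2 + e ^ 2)) ^ (-r / 2) ≤ m / q := by
      calc _ ≤ ((m ^ 2 + e ^ 2) / (q ^ 2 + e ^ 2)) ^ ((1 : ℝ) / 2) :=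
            rpow_le_rpow_of_exponent_le h1 (by linarith)
        _ ≤ ((m / q) ^ 2) ^ ((1 : ℝ) / 2) := by gcongr
        _ = m / q := by rw [← sqrt_eq_rpow, sqrt_sq (by positivity)]
    rw [div_rpow hA.le hB.le, div_le_iff₀ hP] at h3
    calc _ ≤ (m ^ 2 + e ^ 2) ^ (-r / 2) * m⁻¹ * 1 := by gcongr
      _ ≤ (m / q * (q ^ 2 + e ^ 2) ^ (-r / 2)) * m⁻¹ * 1 := by gcongr
      _ = _ := by field_simp
  · have h1 : 1 ≤ (q ^ 2 + e ^ 2) / (m ^ 2 + e ^ 2) := by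
      rw [one_le_div hA]; gcongr
    have h2 : (q ^ 2 + e ^ 2) / (m ^ 2 + e ^ 2) ≤ (q / m) ^ 2 := by
      rw [div_pow, div_le_div_iff₀ hA (by positivity)]
      have : m ^ 2 ≤ q ^ 2 := by gcongr
      nlinarith [sq_nonneg e]
    have h3 : ((q ^ 2 + e ^ 2) / (m ^ 2 + e ^ 2)) ^ (r / 2) ≤ (q / m) ^ 2 := by
      calc _ ≤ ((q ^ 2 + e ^ 2) / (m ^ 2 + e ^ 2)) ^ (1 : ℝ) :=
            rpow_le_rpow_of_exponent_le h1 (by linarith)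
        _ ≤ _ := by rw [rpow_one]; exact h2
    have h4 : ((q ^ 2 + e ^ 2) / (m ^ 2 + e ^ 2)) ^ (r / 2)
        = (m ^ 2 + e ^ 2) ^ (-r / 2) / (q ^ 2 + e ^ 2) ^ (-r / 2) := by
      rw [div_rpow hB.le hA.le, neg_div, rpow_neg hA.le, rpow_neg hB.le]
      field_simp
    rw [h4, div_le_iff₀ hP] at h3
    calc _ ≤ ((q / m) ^ 2 * (q ^ 2 + e ^ 2) ^ (-r / 2)) * m⁻¹ * (m / q) ^ 3 := by gcongr
      _ = _ := by field_simp

lemma aux_rhs (r a b c : ℝ) (ha : 0 < a) (hb : 0 < b) (hc : 0 < c) :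
    a ^ (2 * r - 1) * b ^ (r + 1) / (c⁻¹ * ((c ^ 2)⁻¹ + a ^ 4 * b ^ 2) ^ (r / 2))
      = a ^ (3 * r) * (((a / (b * c)) ^ 2 + (a ^ 3) ^ 2) ^ (-r / 2) * (a / (b * c))⁻¹) := by
  have hB : 0 < (a / (b * c)) ^ 2 + (a ^ 3) ^ 2 := by positivity
  have h1 : (c ^ 2)⁻¹ + a ^ 4 * b ^ 2
      = (b / a) ^ 2 * ((a / (b * c)) ^ 2 + (a ^ 3) ^ 2) := by field_simp
  have h2 : ((b / a) ^ 2) ^ (r / 2) = b ^ r / a ^ r := by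
    rw [← rpow_natCast, ← rpow_mul (by positivity), div_rpow hb.le ha.le]
    congr 2 <;> (push_cast; ring)
  have h3 : a ^ (3 * r) = a ^ r * a ^ (2 * r) := by rw [← rpow_add ha]; ring_nf
  have hP := rpow_pos_of_pos hB (r / 2)
  have hP1 := rpow_pos_of_pos ha r
  have hP2 := rpow_pos_of_pos hb r
  rw [h1, mul_rpow (by positivity) hB.le, h2, neg_div, rpow_neg hB.le, h3, rpow_sub ha,
    rpow_add hb, rpow_one, rpow_one]
  generalize ((a / (b * c)) ^ 2 + (a ^ 3) ^ 2) ^ (r / 2) = X at *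
  field_simp

/-- upper bound in Lemma 2, estimate (3), for `−1 ≤ r ≤ 2`, with a
constant depending only on `r`. -/
theorem stmt15 (r : ℝ) (hr1 : -1 ≤ r) (hr2 : r ≤ 2) :
    ∃ C : ℝ, 0 < C ∧
      ∀ (t ε κ : ℝ) (γ' : ℝ → ℝ), t ≠ 0 → 0 < ε → 0 < κ → γ' 0 ≠ 0 →
        (∀ k : ℝ, |k| ≤ κ → (1 / 2) * |γ' 0| ≤ |γ' k|) →
        (∀ k : ℝ, |k| ≤ κ → |γ' k| ≤ (3 / 2) * |γ' 0|) →
        ε * |t|⁻¹ ≤ (2 * π)⁻¹ * |γ' 0| * κ ^ 3 →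
        ∀ k : ℝ, 0 < |k| → |k| ≤ κ →
          ε ^ r * (k ^ 2 + ε ^ 2) ^ (-r / 2) * |k|⁻¹ *
              |Real.sin ((1 / 2) * t * ε⁻¹ * |k| ^ 3 * γ' k)|
            ≤ C * ε ^ ((2 * r - 1) / 3) * |t| ^ ((r + 1) / 3) /
                (|γ' 0| ^ (-(1:ℝ)/3) *
                  (|γ' 0| ^ (-(2:ℝ)/3) + ε ^ ((4:ℝ)/3) * |t| ^ ((2:ℝ)/3)) ^ (r / 2)) := by
  refine ⟨1, one_pos, ?_⟩
  intro t ε κ γ' ht hε hκ hg _ hup _ k hk hkκ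
  have hT : 0 < |t| := abs_pos.2 ht
  have hG : 0 < |γ' 0| := abs_pos.2 hg
  have hu := hup k hkκ
  have key : ∀ x : ℝ, 0 < x → ∃ y : ℝ, 0 < y ∧ x = y ^ 3 := fun x hx =>
    ⟨x ^ ((1 : ℝ) / 3), by positivity, by
      rw [← rpow_natCast, ← rpow_mul hx.le]; norm_num⟩
  have pw : ∀ y p : ℝ, 0 < y → (y ^ 3) ^ p = y ^ (3 * p) := fun y p hy => by
    rw [← rpow_natCast, ← rpow_mul hy.le]; norm_num
  have hsin : |Real.sin ((1 / 2) * t * ε⁻¹ * |k| ^ 3 * γ' k)|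
      ≤ |t| * ε⁻¹ * |k| ^ 3 * |γ' 0| := by
    refine abs_sin_le_abs.trans ?_
    rw [abs_mul, abs_mul, abs_mul, abs_mul, abs_of_pos (inv_pos.2 hε), abs_pow, abs_abs,
      abs_of_pos (by norm_num : (0 : ℝ) < 1 / 2)]
    have : 0 < |t| * ε⁻¹ * |k| ^ 3 := by positivity
    nlinarith
  have hs1 := abs_sin_le_one ((1 / 2) * t * ε⁻¹ * |k| ^ 3 * γ' k)
  have hs0 := abs_nonneg (Real.sin ((1 / 2) * t * ε⁻¹ * |k| ^ 3 * γ' k))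
  rw [← sq_abs k]
  generalize |Real.sin ((1 / 2) * t * ε⁻¹ * |k| ^ 3 * γ' k)| = s at *
  clear hu hup
  generalize |k| = m at *
  generalize |γ' 0| = g at *
  generalize |t| = T at *
  obtain ⟨a, ha, rfl⟩ := key ε hε
  obtain ⟨b, hb, rfl⟩ := key T hT
  obtain ⟨c, hc, rfl⟩ := key g hG
  have e1 : (3 : ℝ) * ((2 * r - 1) / 3) = 2 * r - 1 := by ring
  have e2 : (3 : ℝ) * ((r + 1) / 3) = r + 1 := by ring
  have e3 : (c ^ 3) ^ (-(1:ℝ)/3) = c⁻¹ := by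
    rw [pw c _ hc, show (3 : ℝ) * (-1 / 3) = -1 by norm_num, rpow_neg_one]
  have e4 : (c ^ 3) ^ (-(2:ℝ)/3) = (c ^ 2)⁻¹ := by
    rw [pw c _ hc, show (3 : ℝ) * (-2 / 3) = -(2 : ℕ) by norm_num, rpow_neg hc.le, rpow_natCast]
  have e5 : (a ^ 3) ^ ((4:ℝ)/3) = a ^ 4 := by
    rw [pw a _ ha, show (3 : ℝ) * (4 / 3) = (4 : ℕ) by norm_num, rpow_natCast]
  have e6 : (b ^ 3) ^ ((2:ℝ)/3) = b ^ 2 := by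
    rw [pw b _ hb, show (3 : ℝ) * (2 / 3) = (2 : ℕ) by norm_num, rpow_natCast]
  rw [e3, e4, e5, e6, pw a _ ha, pw a _ ha, pw b _ hb, e1, e2, one_mul, aux_rhs r a b c ha hb hc,
    mul_assoc, mul_assoc, ← mul_assoc ((m ^ 2 + (a ^ 3) ^ 2) ^ (-r / 2))]
  refine mul_le_mul_of_nonneg_left ?_ (by positivity)
  refine aux_key r (a ^ 3) m (a / (b * c)) s hr1 hr2 hε hk (by positivity) hs0 hs1 ?_
  refine hsin.trans (le_of_eq ?_)
  field_simp
end
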